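/- arXiv:1505.06109 — 3 statements merged into one kernel-verified Lean document; each statement's English description precedes it below -/
import Mathlib

section
/- Let G=(E,V,m) be a locally finite connected weighted graph. Then the operator Δ_{1,sym} on ℓ²_sym(E) is unitarily equivalent to A_{G̃} + V(·,·) acting on ℓ²(Ṽ,1), where V(x,y) := E(x,y)(1/m(x) + 1/m(y)) acts by multiplication and G̃ is the line graph of G; explicitly, the unitary U : ℓ²_sym(E) → ℓ²(Ṽ,1) given by (Uf)(x,y) = √(E(x,y))·f(x,y) maps finitely supported functions onto finitely supported functions and satisfies (U Δ_{1,sym} U⁻¹)f = A_{G̃}f + V·f for every finitely supported f on Ṽ. -/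
open scoped BigOperators ComplexConjugate Classical ENNReal
open MeasureTheory



/-- A weighted graph: countable vertex set `V`, symmetric edge weights `E ≥ 0`
with no loops, and a positive vertex weight `m`. -/
structure WGraph (V : Type*) where
  E : V → V → ℝ
  m : V → ℝ
  symm : ∀ x y, E x y = E y x
  nonneg : ∀ x y, 0 ≤ E x y
  loopless : ∀ x, E x x = 0
  mpos : ∀ x, 0 < m x

namespace WGraph
variable {V : Type*} (G : WGraph V)

/-- `x ∼ y` : neighbors. -/
def Adj (x y : V) : Prop := 0 < G.E x y

/-- Locally finite: every vertex has finitely many neighbors. -/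
def LocallyFinite : Prop := ∀ x, {y | 0 < G.E x y}.Finite

/-- Connected: any two vertices are joined by a path of neighbors. -/
def Connected : Prop := ∀ x y : V, Relation.ReflTransGen G.Adj x y

/-- Simple: all vertex weights are `1` and the edge weights take values in `{0,1}`. -/
def IsSimple : Prop := (∀ x, G.m x = 1) ∧ ∀ x y, G.E x y = 0 ∨ G.E x y = 1

/-- Bipartite. -/
def Bipartite : Prop :=
  ∃ V₁ : Set V, ∀ x y, ((x ∈ V₁ ∧ y ∈ V₁) ∨ (x ∉ V₁ ∧ y ∉ V₁)) → G.E x y = 0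

/-- The (weighted) degree `deg x = (1/m x) Σ_y E x y`. -/
noncomputable def deg (x : V) : ℝ := (1 / G.m x) * ∑' y, G.E x y

/-- The edge weight, as a function on unordered pairs. -/
noncomputable def ew : Sym2 V → ℝ := Sym2.lift ⟨G.E, fun x y => G.symm x y⟩

/-- The set of (unordered) edges of `G`, i.e. the vertex set of the line graph. -/
def EdgeT (G : WGraph V) : Type _ := {e : Sym2 V // 0 < G.ew e}

/-- Auxiliary form of the line-graph edge weight, on unordered pairs. -/
noncomputable def lineEAux : Sym2 V → Sym2 V → ℝ :=
  Sym2.lift₂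
    ⟨fun x y z w =>
      (if x = z then Real.sqrt (G.E x y * G.E z w) / G.m x else 0) +
      (if x = w then Real.sqrt (G.E x y * G.E z w) / G.m x else 0) +
      (if y = z then Real.sqrt (G.E x y * G.E z w) / G.m y else 0) +
      (if y = w then Real.sqrt (G.E x y * G.E z w) / G.m y else 0),
      by
        intro a₁ a₂ b₁ b₂
        constructor
        · simp only [G.symm a₂ a₁]; ring
        · simp only [G.symm b₂ b₁]; ring⟩

/-- The edge weight of the line graph `G̃`:
for distinct edges it is `√(E e · E e')/m v` summed over common vertices `v`
(distinct edges share at most one vertex), and `0` on the diagonal. -/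
noncomputable def lineE (e e' : G.EdgeT) : ℝ :=
  if e = e' then 0 else G.lineEAux e.1 e'.1

end WGraph

namespace WGraph
/-- The common formula for the Laplacians `Δ₁` and `Δ_{1,sym}` on `1`-forms:
`(Δf)(x,y) = (1/m x) Σ_z E(x,z) f(x,z) + (1/m y) Σ_z E(z,y) f(z,y)`. -/
noncomputable def lapFun {V : Type*} (G : WGraph V) (g : V × V → ℂ) : V × V → ℂ := fun p =>
  ((1 / G.m p.1 : ℝ) : ℂ) * ∑' z, (G.E p.1 z : ℂ) * g (p.1, z) +
  ((1 / G.m p.2 : ℝ) : ℂ) * ∑' z, (G.E z p.2 : ℂ) * g (z, p.2)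
end WGraph

namespace WGraph
variable {V : Type*} (G : WGraph V)

/-- The map `U : f ↦ √(E(x,y))·f(x,y)` from (symmetric) functions on `V × V` to functions on
the vertex set `Ṽ` of the line graph. -/
noncomputable def toEdge (g : V × V → ℂ) : G.EdgeT → ℂ :=
  fun e => (Real.sqrt (G.ew e.1) : ℂ) * g (Quot.out e.1)

/-- The inverse map `U⁻¹ : h ↦ h(x,y)/√(E(x,y))` (extended by `0` off the edges). -/
noncomputable def fromEdge (h : G.EdgeT → ℂ) : V × V → ℂ := fun p =>
  if hp : 0 < G.ew s(p.1, p.2) then h ⟨s(p.1, p.2), hp⟩ / (Real.sqrt (G.E p.1 p.2) : ℂ) else 0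

/-- The adjacency matrix of the line graph, acting on functions on `Ṽ`. -/
noncomputable def lineAdjFun (h : G.EdgeT → ℂ) : G.EdgeT → ℂ :=
  fun e => ∑' e' : G.EdgeT, (G.lineE e e' : ℂ) * h e'

/-- The potential `V(x,y) = E(x,y)(1/m(x) + 1/m(y))`, as a function on unordered pairs. -/
noncomputable def linePotential : Sym2 V → ℝ :=
  Sym2.lift ⟨fun x y => G.E x y * (1 / G.m x + 1 / G.m y),
    fun x y => by dsimp only; rw [G.symm x y]; ring⟩

end WGraph


namespace WGraph
variable {V : Type*} (G : WGraph V)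

theorem aux_out (g : V × V → ℂ) (hg : ∀ x y, g (y, x) = g (x, y)) (x y : V) :
    g (Quot.out (s(x, y) : Sym2 V)) = g (x, y) := by
  have h : s((Quot.out (s(x, y) : Sym2 V)).1, (Quot.out (s(x, y) : Sym2 V)).2) = s(x, y) :=
    Quot.out_eq (s(x, y) : Sym2 V)
  generalize Quot.out (s(x, y) : Sym2 V) = p at h
  obtain ⟨a, b⟩ := p
  rcases Sym2.eq_iff.1 h with ⟨h1, h2⟩ | ⟨h1, h2⟩
  · simp only at h1 h2; rw [h1, h2]
  · simp only at h1 h2; rw [h1, h2, hg]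

theorem aux_out_mk (e : Sym2 V) : s((Quot.out e).1, (Quot.out e).2) = e := Quot.out_eq e

theorem aux_ew_out (e : Sym2 V) : G.E (Quot.out e).1 (Quot.out e).2 = G.ew e := by
  conv_rhs => rw [← aux_out_mk e]
  rfl

theorem aux_ne {x y : V} (h : 0 < G.E x y) : x ≠ y := by
  rintro rfl
  rw [G.loopless] at h
  exact lt_irrefl _ h

theorem fromEdge_symm (h : G.EdgeT → ℂ) (x y : V) :
    G.fromEdge h (y, x) = G.fromEdge h (x, y) := by
  simp only [fromEdge]
  have : s(y, x) = s(x, y) := Sym2.eq_swap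
  simp only [this, G.symm y x]

theorem fromEdge_edge (h : G.EdgeT → ℂ) (x y : V) (hp : 0 < G.ew s(x, y)) :
    G.fromEdge h (x, y) = h ⟨s(x, y), hp⟩ / (Real.sqrt (G.E x y) : ℂ) := by
  simp only [fromEdge, dif_pos hp]

theorem lapFun_symm (g : V × V → ℂ) (hg : ∀ x y, g (y, x) = g (x, y)) (x y : V) :
    G.lapFun g (y, x) = G.lapFun g (x, y) := by
  simp only [lapFun]
  rw [add_comm]
  congr 2
  · refine tsum_congr fun z => ?_
    rw [G.symm z x, hg x z]
  · refine tsum_congr fun z => ?_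
    rw [G.symm y z, hg z y]

theorem toEdge_fromEdge (h : G.EdgeT → ℂ) : G.toEdge (G.fromEdge h) = h := by
  funext e
  obtain ⟨e, he⟩ := e
  induction e using Sym2.ind with
  | _ x y =>
    have hE : 0 < G.E x y := he
    simp only [toEdge]
    rw [aux_out _ (G.fromEdge_symm h), G.fromEdge_edge h x y he]
    have h0 : (Real.sqrt (G.E x y) : ℂ) ≠ 0 := by
      exact_mod_cast (Real.sqrt_pos.2 hE).ne'
    have h1 : G.ew s(x, y) = G.E x y := rfl
    rw [h1]
    field_simp

theorem fromEdge_finite (h : G.EdgeT → ℂ) (hf : (Function.support h).Finite) :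
    (Function.support (G.fromEdge h)).Finite := by
  refine ((hf.image fun e => Quot.out e.1).union
    (hf.image fun e => (Quot.out e.1).swap)).subset ?_
  rintro ⟨x, y⟩ hp
  simp only [Function.mem_support, fromEdge] at hp
  by_cases hE : 0 < G.ew s(x, y)
  · rw [dif_pos hE] at hp
    have h1 : h ⟨s(x, y), hE⟩ ≠ 0 := by
      intro h0
      rw [h0] at hp
      simp at hp
    have h2 := aux_out_mk s(x, y)
    rcases Sym2.eq_iff.1 h2 with ⟨h3, h4⟩ | ⟨h3, h4⟩
    · left
      exact ⟨_, h1, Prod.ext h3 h4⟩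
    · right
      exact ⟨_, h1, Prod.ext h4 h3⟩
  · rw [dif_neg hE] at hp
    exact absurd rfl hp

theorem toEdge_finite (g : V × V → ℂ) (hf : (Function.support g).Finite) :
    (Function.support (G.toEdge g)).Finite := by
  have hinj : Function.Injective (fun e : G.EdgeT => Quot.out e.1) := by
    intro a b hab
    apply Subtype.ext
    rw [← aux_out_mk a.1, ← aux_out_mk b.1]
    simp only at hab
    rw [hab]
  refine (hf.preimage hinj.injOn).subset ?_
  intro e he
  simp only [Function.mem_support, toEdge] at he
  exact right_ne_zero_of_mul he

/-- Each edge has exactly two orientations. -/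
noncomputable def orient (q : G.EdgeT × Bool) : V × V :=
  if q.2 then Quot.out q.1.1 else (Quot.out q.1.1).swap

theorem orient_inj : Function.Injective G.orient := by
  rintro ⟨e, b⟩ ⟨e', b'⟩ h
  have key : ∀ (e : G.EdgeT) (b : Bool), s((G.orient (e, b)).1, (G.orient (e, b)).2) = e.1 := by
    intro e b
    cases b
    · simp only [orient, Bool.false_eq_true, if_false, Prod.fst_swap, Prod.snd_swap]
      rw [Sym2.eq_swap]
      exact aux_out_mk e.1
    · simp only [orient, if_true]
      exact aux_out_mk e.1
  have he : e = e' := by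
    apply Subtype.ext
    rw [← key e b, ← key e' b', h]
  subst he
  have hne : (Quot.out e.1).1 ≠ (Quot.out e.1).2 := by
    apply G.aux_ne
    rw [aux_ew_out]
    exact e.2
  cases b <;> cases b'
  · rfl
  · simp only [orient, Bool.false_eq_true, if_false, if_true] at h
    exact absurd (congrArg Prod.snd h) hne
  · simp only [orient, Bool.false_eq_true, if_false, if_true] at h
    exact absurd (congrArg Prod.fst h) hne
  · rfl

theorem orient_range {x y : V} (h : 0 < G.E x y) : (x, y) ∈ Set.range G.orient := by
  have h2 := aux_out_mk s(x, y)
  rcases Sym2.eq_iff.1 h2 with ⟨h3, h4⟩ | ⟨h3, h4⟩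
  · exact ⟨(⟨s(x, y), h⟩, true), by
      simp only [orient, if_true]; exact Prod.ext h3 h4⟩
  · exact ⟨(⟨s(x, y), h⟩, false), by
      simp only [orient, Bool.false_eq_true, if_false]; exact Prod.ext h4 h3⟩

theorem norm_identity (g : V × V → ℂ) (hg : ∀ x y, g (y, x) = g (x, y))
    (hf : (Function.support g).Finite) :
    ∑' e : G.EdgeT, ‖G.toEdge g e‖ ^ 2
        = (1 / 2) * ∑' p : V × V, G.E p.1 p.2 * ‖g p‖ ^ 2 := by
  set F : V × V → ℝ := fun p => G.E p.1 p.2 * ‖g p‖ ^ 2 with hF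
  have hFsymm : ∀ p : V × V, F p.swap = F p := by
    rintro ⟨x, y⟩
    simp only [hF, Prod.swap_prod_mk, hg x y, G.symm y x]
  have hFf : (Function.support F).Finite := by
    refine hf.subset ?_
    intro p hp hp0
    apply hp
    simp [hF, hp0]
  have hsub : Function.support F ⊆ Set.range G.orient := by
    rintro ⟨x, y⟩ hp
    apply G.orient_range
    refine lt_of_le_of_ne (G.nonneg x y) ?_
    intro h0
    apply hp
    simp [hF, ← h0]
  have hs : Summable (fun q : G.EdgeT × Bool => F (G.orient q)) := by
    apply summable_of_hasFiniteSupport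
    exact (hFf.preimage G.orient_inj.injOn)
  rw [← G.orient_inj.tsum_eq hsub, hs.tsum_prod, ← tsum_mul_left]
  refine tsum_congr fun e => ?_
  rw [tsum_bool]
  simp only [orient, Bool.false_eq_true, if_false, if_true]
  rw [hFsymm]
  simp only [hF, toEdge, aux_ew_out, norm_mul, mul_pow]
  rw [Complex.norm_real, Real.norm_eq_abs, sq_abs, Real.sq_sqrt e.2.le]
  ring

theorem star_sum (x : V) (K : G.EdgeT → ℂ) :
    ∑' e : G.EdgeT, (if x ∈ e.1 then K e else 0)
      = ∑' z : V, (if hz : 0 < G.ew s(x, z) then K ⟨s(x, z), hz⟩ else 0) := by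
  let i : {z : V // 0 < G.ew s(x, z)} → G.EdgeT := fun z => ⟨s(x, z.1), z.2⟩
  have hi : Function.Injective i := by
    intro a b hab
    have := congrArg Subtype.val hab
    exact Subtype.ext (Sym2.congr_right.1 this)
  have hj : Function.Injective (Subtype.val : {z : V // 0 < G.ew s(x, z)} → V) :=
    Subtype.val_injective
  rw [← hi.tsum_eq, ← hj.tsum_eq]
  · refine tsum_congr fun z => ?_
    rw [dif_pos z.2, if_pos (Sym2.mem_mk_left x z.1)]
  · intro z hz
    by_cases h : 0 < G.ew s(x, z)
    · exact ⟨⟨z, h⟩, rfl⟩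
    · exact absurd (dif_neg h) hz
  · intro e he
    by_cases h : x ∈ e.1
    · obtain ⟨z, hz⟩ := h
      have h0 : 0 < G.ew s(x, z) := hz ▸ e.2
      exact ⟨⟨z, h0⟩, Subtype.ext hz.symm⟩
    · exact absurd (if_neg h) he

theorem half_sum (x : V) (h : G.EdgeT → ℂ) (c : ℝ) (hc : 0 ≤ c) :
    (Real.sqrt c : ℂ) * ∑' z, (G.E x z : ℂ) * G.fromEdge h (x, z)
      = ∑' e : G.EdgeT, (if x ∈ e.1 then (Real.sqrt (c * G.ew e.1) : ℂ) * h e else 0) := by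
  rw [G.star_sum x (fun e => (Real.sqrt (c * G.ew e.1) : ℂ) * h e), ← tsum_mul_left]
  refine tsum_congr fun z => ?_
  by_cases hz : 0 < G.ew s(x, z)
  · have hE : 0 < G.E x z := hz
    rw [dif_pos hz, G.fromEdge_edge h x z hz]
    have h1 : G.ew s(x, z) = G.E x z := rfl
    have h0 : (Real.sqrt (G.E x z) : ℂ) ≠ 0 := by
      exact_mod_cast (Real.sqrt_pos.2 hE).ne'
    have h2 : (G.E x z : ℂ) = (Real.sqrt (G.E x z) : ℂ) * (Real.sqrt (G.E x z) : ℂ) := by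
      exact_mod_cast (Real.mul_self_sqrt hE.le).symm
    rw [Real.sqrt_mul hc]
    simp only [h1]
    rw [h2]
    push_cast
    field_simp
  · rw [dif_neg hz]
    simp [fromEdge, hz]

theorem kernel_eq (x y : V) (e e' : G.EdgeT) (hxy : e.1 = s(x, y)) :
    G.lineE e e' + (if e' = e then G.linePotential s(x, y) else 0)
      = (1 / G.m x) * (if x ∈ e'.1 then Real.sqrt (G.E x y * G.ew e'.1) else 0)
        + (1 / G.m y) * (if y ∈ e'.1 then Real.sqrt (G.E x y * G.ew e'.1) else 0) := by
  have he : 0 < G.ew s(x, y) := hxy ▸ e.2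
  have hE : 0 < G.E x y := he
  by_cases h : e' = e
  · subst h
    have h1 : G.ew s(x, y) = G.E x y := rfl
    have h2 : G.linePotential s(x, y) = G.E x y * (1 / G.m x + 1 / G.m y) := rfl
    simp only [lineE, if_true, hxy, h1, h2, Sym2.mem_iff, true_or, or_true, Real.sqrt_mul_self hE.le]
    ring
  · rw [if_neg h, lineE, if_neg (Ne.symm h), hxy]
    clear h
    obtain ⟨e', he'⟩ := e'
    induction e' using Sym2.ind with
    | _ z w =>
      have hzw : z ≠ w := G.aux_ne he'
      have h1 : G.ew s(z, w) = G.E z w := rfl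
      have h2 : G.lineEAux s(x, y) s(z, w) =
        (if x = z then Real.sqrt (G.E x y * G.E z w) / G.m x else 0) +
        (if x = w then Real.sqrt (G.E x y * G.E z w) / G.m x else 0) +
        (if y = z then Real.sqrt (G.E x y * G.E z w) / G.m y else 0) +
        (if y = w then Real.sqrt (G.E x y * G.E z w) / G.m y else 0) := rfl
      have key : ∀ (v : V) (a : ℝ), (1 / G.m v) * (if v ∈ s(z, w) then a else 0)
          = (if v = z then a / G.m v else 0) + (if v = w then a / G.m v else 0) := by
        intro v a
        simp only [Sym2.mem_iff]
        by_cases hz : v = z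
        · have hw : v ≠ w := hz ▸ hzw
          simp only [hz, hzw, true_or, if_true, if_false]
          ring
        · by_cases hw : v = w
          · simp only [hw, hzw.symm, or_true, if_true, if_false]
            ring
          · simp [hz, hw]
      simp only [h1, h2, key]
      ring

theorem lap_identity (h : G.EdgeT → ℂ) (hf : (Function.support h).Finite) (e : G.EdgeT) :
    G.toEdge (G.lapFun (G.fromEdge h)) e
        = G.lineAdjFun h e + (G.linePotential e.1 : ℂ) * h e := by
  have hsm : ∀ K : G.EdgeT → ℂ, (∀ e, h e = 0 → K e = 0) → Summable K := by
    intro K hK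
    apply summable_of_hasFiniteSupport
    refine hf.subset ?_
    intro e he h0
    exact he (hK e h0)
  obtain ⟨x, y, hxy⟩ : ∃ x y, e.1 = s(x, y) := ⟨_, _, (aux_out_mk e.1).symm⟩
  · have hE : 0 < G.E x y := by
      have h2 : 0 < G.ew s(x, y) := hxy ▸ e.2
      exact h2
    have h1 : G.ew s(x, y) = G.E x y := rfl
    simp only [toEdge]
    rw [hxy, aux_out _ (G.lapFun_symm _ (G.fromEdge_symm h)), h1]
    have hy : ∑' z, (G.E z y : ℂ) * G.fromEdge h (z, y)
        = ∑' z, (G.E y z : ℂ) * G.fromEdge h (y, z) :=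
      tsum_congr fun z => by rw [G.symm z y, G.fromEdge_symm h y z]
    simp only [lapFun]
    rw [hy, mul_add, mul_left_comm, G.half_sum x h _ hE.le, mul_left_comm,
      G.half_sum y h _ hE.le, ← tsum_mul_left, ← tsum_mul_left]
    have hpot : (G.linePotential s(x, y) : ℂ) * h e
        = ∑' e' : G.EdgeT, (if e' = e then
            (G.linePotential s(x, y) : ℂ) * h e' else 0) := by
      rw [tsum_eq_single e]
      · rw [if_pos rfl]
      · intro b hb
        rw [if_neg hb]
    rw [hpot, lineAdjFun, ← Summable.tsum_add, ← Summable.tsum_add]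
    · refine tsum_congr fun e' => ?_
      have hk := congrArg (fun r : ℝ => (r : ℂ) * h e') (G.kernel_eq x y e e' hxy)
      push_cast at hk
      rw [add_mul, add_mul] at hk
      simp only [ite_mul, mul_ite, zero_mul, mul_zero] at hk ⊢
      push_cast
      simp only [mul_assoc] at hk ⊢
      convert hk.symm using 2 <;> split_ifs <;> simp
    · exact hsm _ fun e h0 => by simp [h0]
    · exact hsm _ fun e h0 => by simp [h0]
    · exact hsm _ fun e h0 => by simp [h0]
    · exact hsm _ fun e h0 => by simp [h0]

end WGraph

/-- For a locally finite connected weighted graph `G`, the operator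
`Δ_{1,sym}` is unitarily equivalent to `A_{G̃} + V(·,·)` via the unitary
`U f (x,y) = √(E(x,y))·f(x,y)`: `U` is a norm-preserving bijection between finitely supported
symmetric functions and finitely supported functions on `Ṽ`, and
`(U Δ_{1,sym} U⁻¹) h = A_{G̃} h + V·h` for every finitely supported `h` on `Ṽ`. -/
theorem lap1sym_unitarily_equivalent_lineGraph_adjacency_add_potential
    {V : Type*} [Countable V] (G : WGraph V) (hlf : G.LocallyFinite)
    (hconn : G.Connected) :
    (∀ g : V × V → ℂ, (∀ x y, g (y, x) = g (x, y)) → (Function.support g).Finite →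
      (Function.support (G.toEdge g)).Finite ∧
      ∑' e : G.EdgeT, ‖G.toEdge g e‖ ^ 2
        = (1 / 2) * ∑' p : V × V, G.E p.1 p.2 * ‖g p‖ ^ 2) ∧
    (∀ h : G.EdgeT → ℂ, (Function.support h).Finite →
      (∃ g : V × V → ℂ, (∀ x y, g (y, x) = g (x, y)) ∧ (Function.support g).Finite ∧
        G.toEdge g = h) ∧
      G.toEdge (G.lapFun (G.fromEdge h))
        = fun e => G.lineAdjFun h e + (G.linePotential e.1 : ℂ) * h e) := by
  exact ⟨fun g hg hf => ⟨G.toEdge_finite g hf, G.norm_identity g hg hf⟩,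
    fun h hf => ⟨⟨G.fromEdge h, G.fromEdge_symm h, G.fromEdge_finite h hf, G.toEdge_fromEdge h⟩,
      funext fun e => G.lap_identity h hf e⟩⟩
end

section
/- Let G=(E,V,m) be a locally finite connected weighted graph such that c := sup_{x,y∈V} E(x,y)(1/m(x) + 1/m(y)) < ∞. Then the adjacency matrix of the line graph G̃ is bounded from below by −c, i.e. ⟨f, A_{G̃}f⟩ ≥ −c‖f‖² for every finitely supported f : Ṽ → ℂ. In particular, if G is simple then ⟨f, A_{G̃}f⟩ ≥ −2‖f‖² for every finitely supported f. -/
open scoped BigOperators ComplexConjugate Classical ENNReal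
open MeasureTheory



theorem WGraph.lineEAux_eq_sum {V : Type*} (G : WGraph V) (T : Finset V) (x y z w : V)
    (hx : x ∈ T) (hy : y ∈ T) :
    G.lineEAux s(x, y) s(z, w) = ∑ v ∈ T,
      (((if x = v then 1 else 0) + (if y = v then 1 else 0)) * (√(G.E x y) / √(G.m v))) *
      (((if z = v then 1 else 0) + (if w = v then 1 else 0)) * (√(G.E z w) / √(G.m v))) := by
  have h1 : ∀ v, (((if x = v then 1 else 0) + (if y = v then 1 else 0)) *
        (√(G.E x y) / √(G.m v))) *
      (((if z = v then 1 else 0) + (if w = v then 1 else 0)) * (√(G.E z w) / √(G.m v)))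
      = (if x = v then ((if z = v then 1 else 0) + (if w = v then 1 else 0)) *
          (√(G.E x y * G.E z w) / G.m v) else 0) +
        (if y = v then ((if z = v then 1 else 0) + (if w = v then 1 else 0)) *
          (√(G.E x y * G.E z w) / G.m v) else 0) := by
    intro v
    have hm : √(G.E x y * G.E z w) / G.m v
        = (√(G.E x y) / √(G.m v)) * (√(G.E z w) / √(G.m v)) := by
      rw [div_mul_div_comm, Real.mul_self_sqrt (G.mpos v).le, Real.sqrt_mul (G.nonneg x y)]
    rw [hm]
    split_ifs <;> ring
  rw [Finset.sum_congr rfl (fun v _ => h1 v), Finset.sum_add_distrib, Finset.sum_ite_eq,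
    Finset.sum_ite_eq, if_pos hx, if_pos hy]
  change (if x = z then Real.sqrt (G.E x y * G.E z w) / G.m x else 0) +
      (if x = w then Real.sqrt (G.E x y * G.E z w) / G.m x else 0) +
      (if y = z then Real.sqrt (G.E x y * G.E z w) / G.m y else 0) +
      (if y = w then Real.sqrt (G.E x y * G.E z w) / G.m y else 0) = _
  simp only [eq_comm (a := z), eq_comm (a := w), add_mul, ite_mul, one_mul, zero_mul]
  ring

theorem WGraph.lineEAux_self_le {V : Type*} (G : WGraph V) (c : ℝ)
    (hc : ∀ x y : V, G.E x y * (1 / G.m x + 1 / G.m y) ≤ c) (e : G.EdgeT) :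
    G.lineEAux e.1 e.1 ≤ c := by
  obtain ⟨e, he⟩ := e
  induction e using Sym2.ind with
  | _ x y =>
  have hE : 0 < G.E x y := he
  have hxy : x ≠ y := by
    rintro rfl
    rw [G.loopless] at hE
    exact lt_irrefl _ hE
  change (if x = x then Real.sqrt (G.E x y * G.E x y) / G.m x else 0) +
      (if x = y then Real.sqrt (G.E x y * G.E x y) / G.m x else 0) +
      (if y = x then Real.sqrt (G.E x y * G.E x y) / G.m y else 0) +
      (if y = y then Real.sqrt (G.E x y * G.E x y) / G.m y else 0) ≤ c
  rw [if_pos rfl, if_neg hxy, if_neg hxy.symm, if_pos rfl, Real.sqrt_mul_self hE.le]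
  refine le_trans (le_of_eq ?_) (hc x y)
  ring

theorem re_gram_nonneg {ι κ : Type*} (s : Finset ι) (T : Finset κ) (b : ι → κ → ℝ) (f : ι → ℂ) :
    0 ≤ (∑ e ∈ s, (starRingEnd ℂ) (f e) *
      ∑ e' ∈ s, ((∑ v ∈ T, b e v * b e' v : ℝ) : ℂ) * f e').re := by
  have h : ∑ e ∈ s, (starRingEnd ℂ) (f e) *
      ∑ e' ∈ s, ((∑ v ∈ T, b e v * b e' v : ℝ) : ℂ) * f e'
      = ∑ v ∈ T, (∑ e ∈ s, (b e v : ℂ) * f e) * (starRingEnd ℂ) (∑ e ∈ s, (b e v : ℂ) * f e) := by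
    simp only [map_sum, map_mul, Complex.conj_ofReal, Complex.ofReal_sum,
      Complex.ofReal_mul, Finset.sum_mul, Finset.mul_sum]
    rw [Finset.sum_comm' (s := T) (t' := s) (s' := fun _ => T) (by simp [and_comm])]
    refine Finset.sum_congr rfl fun e _ => ?_
    rw [Finset.sum_comm]
    refine Finset.sum_congr rfl fun v _ => Finset.sum_congr rfl fun e' _ => ?_
    ring
  rw [h, Complex.re_sum]
  refine Finset.sum_nonneg fun v _ => ?_
  rw [Complex.mul_conj, Complex.ofReal_re]
  exact Complex.normSq_nonneg _

theorem lineGraph_bound_aux {V : Type*} (G : WGraph V) (c : ℝ)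
    (hc : ∀ x y : V, G.E x y * (1 / G.m x + 1 / G.m y) ≤ c)
    (f : G.EdgeT → ℂ) (hf : (Function.support f).Finite) :
      -(c * ∑' e : G.EdgeT, ‖f e‖ ^ 2) ≤
        (∑' e : G.EdgeT, (starRingEnd ℂ) (f e) *
          ∑' e' : G.EdgeT, (G.lineE e e' : ℂ) * f e').re := by
  set s := hf.toFinset with hs
  have h0 : ∀ e, e ∉ s → f e = 0 := by
    intro e he
    simpa [hs] using he
  have e1 : ∑' e : G.EdgeT, ‖f e‖ ^ 2 = ∑ e ∈ s, ‖f e‖ ^ 2 :=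
    tsum_eq_sum fun e he => by simp [h0 e he]
  have e2 : ∀ e, ∑' e' : G.EdgeT, (G.lineE e e' : ℂ) * f e' = ∑ e' ∈ s, (G.lineE e e' : ℂ) * f e' :=
    fun e => tsum_eq_sum fun e he => by simp [h0 e he]
  simp only [e2]
  rw [e1, tsum_eq_sum (s := s) fun e he => by simp [h0 e he]]
  let X : G.EdgeT → V := fun e => (Quot.out e.1).1
  let Y : G.EdgeT → V := fun e => (Quot.out e.1).2
  have hXY : ∀ e : G.EdgeT, s(X e, Y e) = e.1 := fun e => Quot.out_eq e.1
  let T : Finset V := s.image X ∪ s.image Y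
  let b : G.EdgeT → V → ℝ := fun e v =>
    ((if X e = v then 1 else 0) + (if Y e = v then 1 else 0)) * (√(G.E (X e) (Y e)) / √(G.m v))
  have hb : ∀ e ∈ s, ∀ e', G.lineEAux e.1 e'.1 = ∑ v ∈ T, b e v * b e' v := by
    intro e he e'
    rw [← hXY e, ← hXY e']
    exact G.lineEAux_eq_sum T _ _ _ _
      (Finset.mem_union_left _ (Finset.mem_image_of_mem X he))
      (Finset.mem_union_right _ (Finset.mem_image_of_mem Y he))
  have key := re_gram_nonneg s T b f
  have h3 : ∑ e ∈ s, (starRingEnd ℂ) (f e) * ∑ e' ∈ s, ((∑ v ∈ T, b e v * b e' v : ℝ) : ℂ) * f e'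
      = (∑ e ∈ s, (starRingEnd ℂ) (f e) * ∑ e' ∈ s, (G.lineE e e' : ℂ) * f e')
        + ((∑ e ∈ s, G.lineEAux e.1 e.1 * ‖f e‖ ^ 2 : ℝ) : ℂ) := by
    rw [Complex.ofReal_sum, ← Finset.sum_add_distrib]
    refine Finset.sum_congr rfl fun e he => ?_
    have h4 : ∀ e' ∈ s, ((∑ v ∈ T, b e v * b e' v : ℝ) : ℂ) * f e'
        = (G.lineE e e' : ℂ) * f e' + (if e = e' then (G.lineEAux e.1 e.1 : ℂ) * f e else 0) := by
      intro e' _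
      rw [← hb e he e']
      unfold WGraph.lineE
      by_cases h : e = e'
      · subst h
        simp
      · simp [h]
    rw [Finset.sum_congr rfl h4, Finset.sum_add_distrib, Finset.sum_ite_eq, if_pos he, mul_add]
    congr 1
    have h5 := Complex.mul_conj' (f e)
    push_cast
    rw [← h5]
    ring
  rw [h3, Complex.add_re, Complex.ofReal_re] at key
  have h6 : ∑ e ∈ s, G.lineEAux e.1 e.1 * ‖f e‖ ^ 2 ≤ c * ∑ e ∈ s, ‖f e‖ ^ 2 := by
    rw [Finset.mul_sum]
    exact Finset.sum_le_sum fun e _ =>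
      mul_le_mul_of_nonneg_right (G.lineEAux_self_le c hc e) (by positivity)
  linarith

/-- Let `G = (E,V,m)` be a locally finite connected weighted graph such that
`c := sup_{x,y} E(x,y)(1/m(x)+1/m(y)) < ∞` (i.e. `c` is an upper bound for these quantities).
Then the adjacency matrix of the line graph `G̃` is bounded from below by `−c` on the finitely
supported functions; in particular by `−2` if `G` is simple. -/
theorem lineGraph_adjacency_bounded_below {V : Type*} [Countable V] (G : WGraph V)
    (hlf : G.LocallyFinite) (hconn : G.Connected) (c : ℝ)
    (hc : ∀ x y : V, G.E x y * (1 / G.m x + 1 / G.m y) ≤ c) :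
    (∀ f : G.EdgeT → ℂ, (Function.support f).Finite →
      -(c * ∑' e : G.EdgeT, ‖f e‖ ^ 2) ≤
        (∑' e : G.EdgeT, (starRingEnd ℂ) (f e) * ∑' e' : G.EdgeT, (G.lineE e e' : ℂ) * f e').re) ∧
    (G.IsSimple → ∀ f : G.EdgeT → ℂ, (Function.support f).Finite →
      -(2 * ∑' e : G.EdgeT, ‖f e‖ ^ 2) ≤
        (∑' e : G.EdgeT, (starRingEnd ℂ) (f e) * ∑' e' : G.EdgeT, (G.lineE e e' : ℂ) * f e').re) := by
  refine ⟨fun f hf => lineGraph_bound_aux G c hc f hf, fun hS f hf => ?_⟩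
  refine lineGraph_bound_aux G 2 (fun x y => ?_) f hf
  rw [hS.1, hS.1]
  rcases hS.2 x y with h | h <;> rw [h] <;> norm_num
end

section
/- Let G=(E,V,m) be a locally finite connected weighted graph. Then the following are equivalent: (i) Δ₁ is bounded on its domain (there is C with ‖Δ₁f‖ ≤ C‖f‖ for all finitely supported antisymmetric f); (ii) Δ_{1,sym} is bounded on its domain; (iii) Δ₀ is bounded on its domain; (iv) sup_{x∈V} deg(x) < ∞. -/
open scoped BigOperators ComplexConjugate Classical ENNReal
open MeasureTheory



namespace WGraph
variable {V : Type*} (G : WGraph V)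

/-- The squared norm of `ℓ²_anti(E)` and `ℓ²_sym(E)` : `(1/2) Σ_{x,y} E(x,y)|g(x,y)|²`. -/
noncomputable def pairNormSq (g : V × V → ℂ) : ℝ :=
  (1 / 2) * ∑' p : V × V, G.E p.1 p.2 * ‖g p‖ ^ 2

/-- The squared norm of `ℓ²(V,m)` : `Σ_x m(x)|g(x)|²`. -/
noncomputable def vertNormSq (g : V → ℂ) : ℝ := ∑' x : V, G.m x * ‖g x‖ ^ 2

/-- The Laplacian on `0`-forms: `Δ₀ g (x) = (1/m x) Σ_y E(x,y)(g(x) − g(y))`. -/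
noncomputable def lap0Fun (g : V → ℂ) : V → ℂ := fun x =>
  ((1 / G.m x : ℝ) : ℂ) * ∑' y, (G.E x y : ℂ) * (g x - g y)

end WGraph

namespace WGraph
variable {V : Type*} (G : WGraph V)

theorem aux_sq_add (a b : ℂ) : ‖a + b‖ ^ 2 ≤ 2 * ‖a‖ ^ 2 + 2 * ‖b‖ ^ 2 := by
  have h1 := norm_add_le a b
  have h2 : ‖a + b‖ ^ 2 ≤ (‖a‖ + ‖b‖) ^ 2 := by gcongr
  nlinarith [sq_nonneg (‖a‖ - ‖b‖)]

theorem aux_zero {x y : V} (h : ¬ 0 < G.E x y) : G.E x y = 0 :=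
  le_antisymm (not_lt.mp h) (G.nonneg x y)

theorem aux_summable (hlf : G.LocallyFinite) (x : V) : Summable (G.E x) := by
  apply summable_of_finite_support
  apply (hlf x).subset
  intro y hy
  by_contra h
  exact hy (G.aux_zero h)

theorem aux_deg_sum (hlf : G.LocallyFinite) {D : ℝ} (hD : ∀ x, G.deg x ≤ D) (S : Finset V)
    (x : V) : ∑ y ∈ S, G.E x y ≤ D * G.m x := by
  have h1 : ∑ y ∈ S, G.E x y ≤ ∑' y, G.E x y :=
    (G.aux_summable hlf x).sum_le_tsum S (fun y _ => G.nonneg x y)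
  have h2 := hD x
  have hm := G.mpos x
  unfold deg at h2
  rw [one_div_mul_eq_div, div_le_iff₀ hm] at h2
  exact h1.trans h2

/-- Weighted Cauchy-Schwarz bound. -/
theorem aux_cs {D : ℝ} (S : Finset V) (x : V)
    (hS : ∑ y ∈ S, G.E x y ≤ D * G.m x) (f : V → ℂ) :
    G.m x * ‖((1 / G.m x : ℝ) : ℂ) * ∑ z ∈ S, (G.E x z : ℂ) * f z‖ ^ 2 ≤
      D * ∑ z ∈ S, G.E x z * ‖f z‖ ^ 2 := by
  have hm := G.mpos x
  have h1 : ‖∑ z ∈ S, (G.E x z : ℂ) * f z‖ ≤ ∑ z ∈ S, G.E x z * ‖f z‖ := by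
    refine (norm_sum_le _ _).trans (le_of_eq ?_)
    refine Finset.sum_congr rfl fun z _ => ?_
    rw [norm_mul, Complex.norm_real, Real.norm_of_nonneg (G.nonneg x z)]
  have h2 : (∑ z ∈ S, G.E x z * ‖f z‖) ^ 2 ≤
      (∑ z ∈ S, G.E x z) * ∑ z ∈ S, G.E x z * ‖f z‖ ^ 2 := by
    apply Finset.sum_sq_le_sum_mul_sum_of_sq_eq_mul
    · intro i _; exact G.nonneg x i
    · intro i _; exact mul_nonneg (G.nonneg x i) (sq_nonneg _)
    · intro i _; ring
  have h0 : 0 ≤ ∑ z ∈ S, G.E x z * ‖f z‖ ^ 2 :=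
    Finset.sum_nonneg fun z _ => mul_nonneg (G.nonneg x z) (sq_nonneg _)
  have h3 : ‖∑ z ∈ S, (G.E x z : ℂ) * f z‖ ^ 2 ≤
      D * G.m x * ∑ z ∈ S, G.E x z * ‖f z‖ ^ 2 := by
    calc _ ≤ (∑ z ∈ S, G.E x z * ‖f z‖) ^ 2 := by gcongr
      _ ≤ _ := h2
      _ ≤ _ := by gcongr
  rw [norm_mul, Complex.norm_real, Real.norm_of_nonneg (by positivity), mul_pow]
  calc G.m x * ((1 / G.m x) ^ 2 * ‖∑ z ∈ S, (G.E x z : ℂ) * f z‖ ^ 2)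
      = (1 / G.m x) * ‖∑ z ∈ S, (G.E x z : ℂ) * f z‖ ^ 2 := by field_simp
    _ ≤ (1 / G.m x) * (D * G.m x * ∑ z ∈ S, G.E x z * ‖f z‖ ^ 2) := by gcongr
    _ = _ := by field_simp

theorem aux_one_side {D : ℝ} (hD0 : 0 ≤ D) (S : Finset V)
    (hS : ∀ x, ∑ y ∈ S, G.E x y ≤ D * G.m x) (a : V → ℂ) :
    ∑ x ∈ S, ∑ y ∈ S, G.E x y * ‖a x‖ ^ 2 ≤ D * ∑ x ∈ S, G.m x * ‖a x‖ ^ 2 := by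
  rw [Finset.mul_sum]
  refine Finset.sum_le_sum fun x _ => ?_
  rw [← Finset.sum_mul, ← mul_assoc]
  exact mul_le_mul_of_nonneg_right (hS x) (sq_nonneg _)

theorem aux_two_side {D : ℝ} (hD0 : 0 ≤ D) (S : Finset V)
    (hS : ∀ x, ∑ y ∈ S, G.E x y ≤ D * G.m x) (a b : V → ℂ) :
    ∑ x ∈ S, ∑ y ∈ S, G.E x y * ‖a x + b y‖ ^ 2 ≤
      2 * D * ∑ x ∈ S, G.m x * ‖a x‖ ^ 2 + 2 * D * ∑ x ∈ S, G.m x * ‖b x‖ ^ 2 := by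
  have h1 := G.aux_one_side hD0 S hS a
  have h2 := G.aux_one_side hD0 S hS b
  have h3 : ∑ x ∈ S, ∑ y ∈ S, G.E x y * ‖b y‖ ^ 2 =
      ∑ x ∈ S, ∑ y ∈ S, G.E x y * ‖b x‖ ^ 2 := by
    rw [Finset.sum_comm]
    refine Finset.sum_congr rfl fun x _ => Finset.sum_congr rfl fun y _ => ?_
    rw [G.symm]
  have h4 : ∑ x ∈ S, ∑ y ∈ S, G.E x y * ‖a x + b y‖ ^ 2 ≤
      2 * ∑ x ∈ S, ∑ y ∈ S, G.E x y * ‖a x‖ ^ 2 +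
      2 * ∑ x ∈ S, ∑ y ∈ S, G.E x y * ‖b y‖ ^ 2 := by
    simp only [Finset.mul_sum, ← Finset.sum_add_distrib]
    refine Finset.sum_le_sum fun x _ => Finset.sum_le_sum fun y _ => ?_
    have := mul_le_mul_of_nonneg_left (aux_sq_add (a x) (b y)) (G.nonneg x y)
    linarith
  rw [h3] at h4
  linarith

theorem aux_nbhd (hlf : G.LocallyFinite) (T : Finset V) :
    ∃ S : Finset V, T ⊆ S ∧ ∀ x ∈ T, ∀ y, 0 < G.E x y → y ∈ S := by
  refine ⟨T ∪ T.biUnion (fun x => (hlf x).toFinset), Finset.subset_union_left, ?_⟩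
  intro x hx y hy
  apply Finset.mem_union_right
  rw [Finset.mem_biUnion]
  exact ⟨x, hx, by simpa using hy⟩

theorem pair_bound (hlf : G.LocallyFinite) {D : ℝ} (hD0 : 0 ≤ D) (hD : ∀ x, G.deg x ≤ D)
    (g : V × V → ℂ) (hg : (Function.support g).Finite) :
    G.pairNormSq (G.lapFun g) ≤ (2 * D) ^ 2 * G.pairNormSq g := by
  let T : Finset V := hg.toFinset.image Prod.fst ∪ hg.toFinset.image Prod.snd
  have hT1 : ∀ x y, x ∉ T → g (x, y) = 0 := by
    intro x y hx
    by_contra h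
    exact hx (Finset.mem_union_left _ (Finset.mem_image.mpr ⟨(x, y), by simpa using h, rfl⟩))
  have hT2 : ∀ x y, y ∉ T → g (x, y) = 0 := by
    intro x y hx
    by_contra h
    exact hx (Finset.mem_union_right _ (Finset.mem_image.mpr ⟨(x, y), by simpa using h, rfl⟩))
  obtain ⟨S, hTS, hSn⟩ := G.aux_nbhd hlf T
  have hS := G.aux_deg_sum hlf hD S
  let a : V → ℂ := fun x => ((1 / G.m x : ℝ) : ℂ) * ∑ z ∈ S, (G.E x z : ℂ) * g (x, z)
  let b : V → ℂ := fun x => ((1 / G.m x : ℝ) : ℂ) * ∑ z ∈ S, (G.E x z : ℂ) * g (z, x)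
  have hlap : ∀ x y, G.lapFun g (x, y) = a x + b y := by
    intro x y
    simp only [lapFun, a, b]
    congr 2
    · apply tsum_eq_sum
      intro z hz
      rw [hT2 x z (fun h => hz (hTS h)), mul_zero]
    · rw [tsum_eq_sum (s := S)]
      · refine Finset.sum_congr rfl fun z _ => ?_
        rw [G.symm]
      · intro z hz
        rw [hT1 z y (fun h => hz (hTS h)), mul_zero]
  have ha : ∀ x, x ∉ T → a x = 0 := by
    intro x hx
    simp [a, hT1 x _ hx]
  have hb : ∀ x, x ∉ T → b x = 0 := by
    intro x hx
    simp [b, hT2 _ x hx]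
  have e1 : G.pairNormSq g = (1 / 2) * ∑ x ∈ S, ∑ y ∈ S, G.E x y * ‖g (x, y)‖ ^ 2 := by
    unfold pairNormSq
    rw [tsum_eq_sum (s := S ×ˢ S), Finset.sum_product]
    rintro ⟨x, y⟩ hp
    rw [Finset.mem_product, not_and_or] at hp
    rcases hp with h | h
    · simp [hT1 x y (fun h' => h (hTS h'))]
    · simp [hT2 x y (fun h' => h (hTS h'))]
  have e2 : G.pairNormSq (G.lapFun g) =
      (1 / 2) * ∑ x ∈ S, ∑ y ∈ S, G.E x y * ‖a x + b y‖ ^ 2 := by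
    unfold pairNormSq
    rw [tsum_eq_sum (s := S ×ˢ S), Finset.sum_product]
    · simp only [hlap]
    rintro ⟨x, y⟩ hp
    rw [Finset.mem_product, not_and_or] at hp
    rw [hlap]
    by_cases hE : 0 < G.E x y
    · have hx : x ∉ T := by
        intro hx
        rcases hp with h | h
        · exact h (hTS hx)
        · exact h (hSn x hx y hE)
      have hy : y ∉ T := by
        intro hy
        rcases hp with h | h
        · exact h (hSn y hy x (by rw [G.symm]; exact hE))
        · exact h (hTS hy)
      simp [ha x hx, hb y hy]
    · simp [G.aux_zero hE]
  have key := G.aux_two_side hD0 S hS a b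
  have ka : ∑ x ∈ S, G.m x * ‖a x‖ ^ 2 ≤ D * ∑ x ∈ S, ∑ y ∈ S, G.E x y * ‖g (x, y)‖ ^ 2 := by
    rw [Finset.mul_sum]
    exact Finset.sum_le_sum fun x _ => G.aux_cs S x (hS x) (fun z => g (x, z))
  have kb : ∑ x ∈ S, G.m x * ‖b x‖ ^ 2 ≤ D * ∑ x ∈ S, ∑ y ∈ S, G.E x y * ‖g (x, y)‖ ^ 2 := by
    rw [Finset.sum_comm, Finset.mul_sum]
    refine Finset.sum_le_sum fun x _ => ?_
    refine (G.aux_cs S x (hS x) (fun z => g (z, x))).trans (le_of_eq ?_)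
    congr 1
    refine Finset.sum_congr rfl fun z _ => ?_
    rw [G.symm]
  rw [e1, e2]
  have ka' := mul_le_mul_of_nonneg_left ka hD0
  have kb' := mul_le_mul_of_nonneg_left kb hD0
  nlinarith

theorem vert_bound (hlf : G.LocallyFinite) {D : ℝ} (hD0 : 0 ≤ D) (hD : ∀ x, G.deg x ≤ D)
    (g : V → ℂ) (hg : (Function.support g).Finite) :
    G.vertNormSq (G.lap0Fun g) ≤ (2 * D) ^ 2 * G.vertNormSq g := by
  let T : Finset V := hg.toFinset
  have hT : ∀ x, x ∉ T → g x = 0 := by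
    intro x hx
    by_contra h
    exact hx (by simpa [T] using h)
  obtain ⟨S₁, hTS₁, hSn₁⟩ := G.aux_nbhd hlf T
  obtain ⟨S, hS₁S, hSn⟩ := G.aux_nbhd hlf S₁
  have hTS : T ⊆ S := hTS₁.trans hS₁S
  have hS := G.aux_deg_sum hlf hD S
  have hout : ∀ x, x ∉ S₁ → ∀ y, (G.E x y : ℂ) * (g x - g y) = 0 := by
    intro x hx y
    by_cases hE : 0 < G.E x y
    · have h1 : x ∉ T := fun h => hx (hTS₁ h)
      have h2 : y ∉ T := fun h => hx (hSn₁ y h x (by rw [G.symm]; exact hE))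
      simp [hT x h1, hT y h2]
    · simp [G.aux_zero hE]
  have hlap : ∀ x, G.lap0Fun g x =
      ((1 / G.m x : ℝ) : ℂ) * ∑ z ∈ S, (G.E x z : ℂ) * (g x - g z) := by
    intro x
    unfold lap0Fun
    congr 1
    apply tsum_eq_sum
    intro y hy
    by_cases hx : x ∈ S₁
    · have : ¬ 0 < G.E x y := fun h => hy (hSn x hx y h)
      simp [G.aux_zero this]
    · exact hout x hx y
  have e1 : G.vertNormSq g = ∑ x ∈ S, G.m x * ‖g x‖ ^ 2 := by
    unfold vertNormSq
    apply tsum_eq_sum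
    intro x hx
    simp [hT x (fun h => hx (hTS h))]
  have e2 : G.vertNormSq (G.lap0Fun g) = ∑ x ∈ S, G.m x *
      ‖((1 / G.m x : ℝ) : ℂ) * ∑ z ∈ S, (G.E x z : ℂ) * (g x - g z)‖ ^ 2 := by
    unfold vertNormSq
    rw [tsum_eq_sum (s := S)]
    · simp only [hlap]
    intro x hx
    rw [hlap, Finset.sum_eq_zero (fun z _ => hout x (fun h => hx (hS₁S h)) z)]
    simp
  have key := G.aux_two_side hD0 S hS g (fun y => - g y)
  simp only [norm_neg, ← sub_eq_add_neg] at key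
  have ka : ∑ x ∈ S, G.m x *
      ‖((1 / G.m x : ℝ) : ℂ) * ∑ z ∈ S, (G.E x z : ℂ) * (g x - g z)‖ ^ 2 ≤
      D * ∑ x ∈ S, ∑ y ∈ S, G.E x y * ‖g x - g y‖ ^ 2 := by
    rw [Finset.mul_sum]
    exact Finset.sum_le_sum fun x _ => G.aux_cs S x (hS x) (fun z => g x - g z)
  rw [e1, e2]
  have kb := mul_le_mul_of_nonneg_left key hD0
  nlinarith

theorem deg_nonneg (x : V) : 0 ≤ G.deg x := by
  unfold deg
  exact mul_nonneg (one_div_nonneg.mpr (G.mpos x).le) (tsum_nonneg fun y => G.nonneg x y)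

theorem sq_of_sqrt {A B C : ℝ} (hB : 0 ≤ B) (h : √A ≤ C * √B) :
    A ≤ C ^ 2 * B := by
  by_cases hA : 0 ≤ A
  · have h1 : √A ^ 2 ≤ (C * √B) ^ 2 := by gcongr
    rwa [mul_pow, Real.sq_sqrt hA, Real.sq_sqrt hB] at h1
  · have : 0 ≤ C ^ 2 * B := by positivity
    linarith

theorem sqrt_of_sq {A B C : ℝ} (hC : 0 ≤ C) (h : A ≤ C ^ 2 * B) :
    √A ≤ C * √B := by
  have := Real.sqrt_le_sqrt h
  rwa [Real.sqrt_mul (sq_nonneg C), Real.sqrt_sq hC] at this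

theorem vertNormSq_nonneg (g : V → ℂ) : 0 ≤ G.vertNormSq g :=
  tsum_nonneg fun x => mul_nonneg (G.mpos x).le (sq_nonneg _)

theorem pairNormSq_nonneg (g : V × V → ℂ) : 0 ≤ G.pairNormSq g :=
  mul_nonneg (by norm_num) (tsum_nonneg fun _ => mul_nonneg (G.nonneg _ _) (sq_nonneg _))

theorem vert_conv (hlf : G.LocallyFinite) {C : ℝ}
    (h : ∀ g : V → ℂ, (Function.support g).Finite →
        √(G.vertNormSq (G.lap0Fun g)) ≤ C * √(G.vertNormSq g)) (a : V) :
    G.deg a ≤ |C| := by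
  let g : V → ℂ := fun x => if x = a then 1 else 0
  have hfin : (Function.support g).Finite := by
    apply (Set.finite_singleton a).subset
    intro x hx
    by_contra hxa
    exact hx (if_neg hxa)
  have h1 := sq_of_sqrt (G.vertNormSq_nonneg g) (h g hfin)
  have e1 : G.vertNormSq g = G.m a := by
    unfold vertNormSq
    rw [tsum_eq_single a]
    · simp [g]
    · intro x hx
      simp [g, hx]
  have e2 : G.lap0Fun g a = (G.deg a : ℂ) := by
    unfold lap0Fun deg
    push_cast
    congr 1
    refine tsum_congr fun y => ?_
    by_cases hy : y = a
    · subst hy; simp [G.loopless]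
    · simp [g, hy]
  have hsum : Summable fun x => G.m x * ‖G.lap0Fun g x‖ ^ 2 := by
    apply summable_of_finite_support
    apply ((hlf a).union (Set.finite_singleton a)).subset
    intro x hx
    by_contra hn
    rw [Set.mem_union, not_or] at hn
    apply hx
    have hxa : x ≠ a := hn.2
    have : G.lap0Fun g x = 0 := by
      unfold lap0Fun
      have hz : ∀ y, (G.E x y : ℂ) * (g x - g y) = 0 := by
        intro y
        by_cases hy : y = a
        · subst hy
          have : ¬ 0 < G.E x y := by rw [G.symm]; exact hn.1
          simp [G.aux_zero this]
        · simp [g, hy, hxa]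
      simp [hz]
    simp [this]
  have h2 : G.m a * ‖G.lap0Fun g a‖ ^ 2 ≤ G.vertNormSq (G.lap0Fun g) :=
    hsum.le_tsum a fun x _ => mul_nonneg (G.mpos x).le (sq_nonneg _)
  rw [e2, Complex.norm_real, Real.norm_of_nonneg (G.deg_nonneg a)] at h2
  rw [e1] at h1
  have h3 : G.deg a ^ 2 ≤ C ^ 2 := by
    have := G.mpos a
    by_contra hc
    push Not at hc
    nlinarith
  have := Real.sqrt_le_sqrt h3
  rwa [Real.sqrt_sq (G.deg_nonneg a), Real.sqrt_sq_eq_abs] at this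

theorem pair_conv (hlf : G.LocallyFinite) {C : ℝ} (s : ℂ) (hs : s * s = 1)
    (h : ∀ g : V × V → ℂ, (∀ x y, g (y, x) = s * g (x, y)) → (Function.support g).Finite →
        √(G.pairNormSq (G.lapFun g)) ≤ C * √(G.pairNormSq g)) (a : V) :
    G.deg a ≤ √(2 * C ^ 2) := by
  let N : Finset V := (hlf a).toFinset
  have hN : ∀ y, y ∈ N ↔ 0 < G.E a y := by intro y; simp [N]
  have haN : a ∉ N := by rw [hN, G.loopless]; exact lt_irrefl 0
  have hne : ∀ y ∈ N, y ≠ a := fun y hy h => haN (h ▸ hy)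
  have hsn : ‖s‖ = 1 := by
    have h1 : ‖s‖ * ‖s‖ = 1 := by rw [← norm_mul, hs, norm_one]
    nlinarith [norm_nonneg s]
  let g : V × V → ℂ := fun p =>
    if p.1 = a ∧ p.2 ∈ N then 1 else if p.2 = a ∧ p.1 ∈ N then s else 0
  have hg1 : ∀ y ∈ N, g (a, y) = 1 := fun y hy => by simp [g, hy]
  have hg2 : ∀ y ∈ N, g (y, a) = s := fun y hy => by simp [g, hy, haN]
  have hg0 : ∀ x y, ¬ (x = a ∧ y ∈ N) → ¬ (y = a ∧ x ∈ N) → g (x, y) = 0 := by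
    intro x y h1 h2
    simp only [g]
    rw [if_neg h1, if_neg h2]
  have hsym : ∀ x y, g (y, x) = s * g (x, y) := by
    intro x y
    by_cases h1 : x = a ∧ y ∈ N
    · obtain ⟨rfl, hy⟩ := h1
      rw [hg1 y hy, hg2 y hy, mul_one]
    · by_cases h2 : y = a ∧ x ∈ N
      · obtain ⟨rfl, hx⟩ := h2
        rw [hg1 x hx, hg2 x hx, hs]
      · rw [hg0 x y h1 h2, hg0 y x h2 h1, mul_zero]
  let S : Finset V := insert a N
  have hsup : ∀ x y, g (x, y) ≠ 0 → x ∈ S ∧ y ∈ S := by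
    intro x y hxy
    by_cases h1 : x = a ∧ y ∈ N
    · exact ⟨by simp [S, h1.1], by simp [S, h1.2]⟩
    · by_cases h2 : y = a ∧ x ∈ N
      · exact ⟨by simp [S, h2.2], by simp [S, h2.1]⟩
      · exact absurd (hg0 x y h1 h2) hxy
  have hfin : (Function.support g).Finite := by
    apply (S ×ˢ S).finite_toSet.subset
    rintro ⟨x, y⟩ hxy
    have := hsup x y hxy
    simpa using this
  have h1 := sq_of_sqrt (G.pairNormSq_nonneg g) (h g hsym hfin)
  have htot : ∑' y, G.E a y = ∑ y ∈ N, G.E a y := by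
    apply tsum_eq_sum
    intro y hy
    rw [hN] at hy
    exact G.aux_zero hy
  have hdeg : ∑ y ∈ N, G.E a y = G.m a * G.deg a := by
    unfold deg
    have := G.mpos a
    rw [htot]; field_simp
  -- the norm of g
  have e1 : G.pairNormSq g = ∑ y ∈ N, G.E a y := by
    unfold pairNormSq
    rw [tsum_eq_sum (s := S ×ˢ S), Finset.sum_product]
    · rw [Finset.sum_insert haN, Finset.sum_insert haN, G.loopless]
      have t1 : ∑ y ∈ N, G.E a y * ‖g (a, y)‖ ^ 2 = ∑ y ∈ N, G.E a y :=
        Finset.sum_congr rfl fun y hy => by rw [hg1 y hy]; simp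
      have t2 : ∑ x ∈ N, ∑ y ∈ S, G.E x y * ‖g (x, y)‖ ^ 2 = ∑ y ∈ N, G.E a y := by
        refine Finset.sum_congr rfl fun x hx => ?_
        rw [Finset.sum_insert haN, hg2 x hx, hsn, Finset.sum_eq_zero, G.symm]
        · simp
        · intro y hy
          rw [hg0 x y (fun h => hne x hx h.1) (fun h => hne y hy h.1)]
          simp
      simp only [t1, t2]
      ring
    · rintro ⟨x, y⟩ hp
      have : g (x, y) = 0 := by
        by_contra hc
        exact hp (by simpa using hsup x y hc)
      simp [this]
  have hlap : ∀ y ∈ N, G.lapFun g (a, y) = ((G.deg a + G.E a y / G.m y : ℝ) : ℂ) := by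
    intro y hy
    have t1 : ∑' z, (G.E a z : ℂ) * g (a, z) = ((∑' z, G.E a z : ℝ) : ℂ) := by
      rw [Complex.ofReal_tsum]
      refine tsum_congr fun z => ?_
      by_cases hz : z ∈ N
      · rw [hg1 z hz, mul_one]
      · rw [hN] at hz
        simp [G.aux_zero hz]
    have t2 : ∑' z, (G.E z y : ℂ) * g (z, y) = (G.E a y : ℂ) := by
      rw [tsum_eq_single a]
      · rw [hg1 y hy, mul_one]
      · intro z hz
        rw [hg0 z y (fun h => hz h.1) (fun h => hne y hy h.1), mul_zero]
    simp only [lapFun, t1, t2, deg]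
    push_cast
    ring
  have hsum : Summable fun p : V × V => G.E p.1 p.2 * ‖G.lapFun g p‖ ^ 2 := by
    obtain ⟨S', hS', hSn'⟩ := G.aux_nbhd hlf S
    apply summable_of_finite_support
    apply (S' ×ˢ S').finite_toSet.subset
    rintro ⟨x, y⟩ hxy
    by_contra hp
    apply hxy
    have hp' : x ∉ S' ∨ y ∉ S' := by
      rw [← not_and_or]
      intro h
      exact hp (by simpa using h)
    by_cases hE : 0 < G.E x y
    · have hx : x ∉ S := by
        intro hx
        rcases hp' with h | h
        · exact h (hS' hx)
        · exact h (hSn' x hx y hE)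
      have hy : y ∉ S := by
        intro hy
        rcases hp' with h | h
        · exact h (hSn' y hy x (by rw [G.symm]; exact hE))
        · exact h (hS' hy)
      have z1 : ∀ z, g (x, z) = 0 := fun z => by
        by_contra hc; exact hx (hsup x z hc).1
      have z2 : ∀ z, g (z, y) = 0 := fun z => by
        by_contra hc; exact hy (hsup z y hc).2
      simp [lapFun, z1, z2]
    · simp [G.aux_zero hE]
  have h2 : ∑ p ∈ ({a} : Finset V) ×ˢ N, G.E p.1 p.2 * ‖G.lapFun g p‖ ^ 2 ≤
      ∑' p : V × V, G.E p.1 p.2 * ‖G.lapFun g p‖ ^ 2 :=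
    hsum.sum_le_tsum _ fun p _ => mul_nonneg (G.nonneg _ _) (sq_nonneg _)
  rw [Finset.sum_product, Finset.sum_singleton] at h2
  have h3 : ∑ y ∈ N, G.E a y * G.deg a ^ 2 ≤ ∑ y ∈ N, G.E a y * ‖G.lapFun g (a, y)‖ ^ 2 := by
    refine Finset.sum_le_sum fun y hy => ?_
    have hd := G.deg_nonneg a
    have hq : 0 ≤ G.E a y / G.m y := div_nonneg (G.nonneg _ _) (G.mpos y).le
    rw [hlap y hy, Complex.norm_real, Real.norm_of_nonneg (add_nonneg hd hq)]
    apply mul_le_mul_of_nonneg_left _ (G.nonneg _ _)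
    gcongr
    linarith
  rw [← Finset.sum_mul, hdeg] at h3
  rw [e1, hdeg] at h1
  have h4 : (1 / 2) * (G.m a * G.deg a * G.deg a ^ 2) ≤ C ^ 2 * (G.m a * G.deg a) := by
    refine le_trans ?_ h1
    unfold pairNormSq
    exact mul_le_mul_of_nonneg_left (h3.trans h2) (by norm_num)
  rcases (G.deg_nonneg a).eq_or_lt with h0 | h0
  · rw [← h0]; exact Real.sqrt_nonneg _
  · apply Real.le_sqrt_of_sq_le
    have hpos : 0 < G.m a * G.deg a := mul_pos (G.mpos a) h0
    by_contra hc
    push Not at hc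
    nlinarith

end WGraph

/-- For a locally finite connected weighted graph the following are
equivalent: `Δ₁` is bounded on its domain, `Δ_{1,sym}` is bounded on its domain, `Δ₀` is
bounded on its domain, and the degree is bounded. -/
theorem lap1_bounded_iff_lap1sym_bounded_iff_lap0_bounded_iff_deg_bounded
    {V : Type*} [Countable V] (G : WGraph V) (hlf : G.LocallyFinite) (hconn : G.Connected) :
    ((∃ C : ℝ, ∀ g : V × V → ℂ, (∀ x y, g (y, x) = - g (x, y)) →
        (Function.support g).Finite →
        Real.sqrt (G.pairNormSq (G.lapFun g)) ≤ C * Real.sqrt (G.pairNormSq g)) ↔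
      (∃ D : ℝ, ∀ x, G.deg x ≤ D)) ∧
    ((∃ C : ℝ, ∀ g : V × V → ℂ, (∀ x y, g (y, x) = g (x, y)) →
        (Function.support g).Finite →
        Real.sqrt (G.pairNormSq (G.lapFun g)) ≤ C * Real.sqrt (G.pairNormSq g)) ↔
      (∃ D : ℝ, ∀ x, G.deg x ≤ D)) ∧
    ((∃ C : ℝ, ∀ g : V → ℂ, (Function.support g).Finite →
        Real.sqrt (G.vertNormSq (G.lap0Fun g)) ≤ C * Real.sqrt (G.vertNormSq g)) ↔
      (∃ D : ℝ, ∀ x, G.deg x ≤ D)) := by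
  have hmax : ∀ {D : ℝ}, (∀ x, G.deg x ≤ D) → ∀ x, G.deg x ≤ max D 0 :=
    fun hD x => (hD x).trans (le_max_left _ _)
  refine ⟨⟨?_, ?_⟩, ⟨?_, ?_⟩, ⟨?_, ?_⟩⟩
  · rintro ⟨C, hC⟩
    refine ⟨_, G.pair_conv hlf (C := C) (-1) (by norm_num) fun g hg hf => hC g ?_ hf⟩
    intro x y
    rw [hg x y, neg_one_mul]
  · rintro ⟨D, hD⟩
    exact ⟨2 * max D 0, fun g _ hf => WGraph.sqrt_of_sq (by positivity)
      (G.pair_bound hlf (le_max_right _ _) (hmax hD) g hf)⟩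
  · rintro ⟨C, hC⟩
    refine ⟨_, G.pair_conv hlf (C := C) 1 (by norm_num) fun g hg hf => hC g ?_ hf⟩
    intro x y
    rw [hg x y, one_mul]
  · rintro ⟨D, hD⟩
    exact ⟨2 * max D 0, fun g _ hf => WGraph.sqrt_of_sq (by positivity)
      (G.pair_bound hlf (le_max_right _ _) (hmax hD) g hf)⟩
  · rintro ⟨C, hC⟩
    exact ⟨_, G.vert_conv hlf hC⟩
  · rintro ⟨D, hD⟩
    exact ⟨2 * max D 0, fun g hf => WGraph.sqrt_of_sq (by positivity)
      (G.vert_bound hlf (le_max_right _ _) (hmax hD) g hf)⟩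
end
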